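/- Let X be a compact metric space, let a, b > 0, and let μ, ν, η be finite signed Borel measures on X. Then the signed generalized Wasserstein distance is invariant under common additions of mass: 𝐖₁^{a,b}(μ + η, ν + η) = 𝐖₁^{a,b}(μ, ν). -/

import Mathlib

open MeasureTheory Filter Metric
open scoped ENNReal

section Defs

variable {X : Type*} [MeasurableSpace X] [MetricSpace X]

/-- A transference plan (coupling) between `μ` and `ν`: a measure on `X × X`
whose marginals are `μ` and `ν`. -/
def IsCoupling (μ ν : Measure X) (π : Measure (X × X)) : Prop :=
  π.map Prod.fst = μ ∧ π.map Prod.snd = ν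

/-- The 1-Wasserstein distance between two (nonnegative) measures of equal mass:
the infimum over couplings of the transport cost. -/
noncomputable def W1 (μ ν : Measure X) : ℝ :=
  sInf { r : ℝ | ∃ π : Measure (X × X), IsCoupling μ ν π ∧
    r = ∫ p : X × X, dist p.1 p.2 ∂π }

/-- The total variation norm `‖μ - ν‖` of the difference of two finite measures. -/
noncomputable def tvNorm (μ ν : Measure X) : ℝ :=
  ((μ - ν) Set.univ + (ν - μ) Set.univ).toReal

/-- The generalized Wasserstein distance `W₁^{a,b}` between two finite nonnegative
measures, possibly of different total mass (Piccoli–Rossi). -/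
noncomputable def genW (a b : ℝ) (μ ν : Measure X) : ℝ :=
  sInf { r : ℝ | ∃ μ' ν' : Measure X, IsFiniteMeasure μ' ∧ IsFiniteMeasure ν' ∧
    μ' Set.univ = ν' Set.univ ∧
    r = a * (tvNorm μ μ' + tvNorm ν ν') + b * W1 μ' ν' }

/-- The signed generalized Wasserstein distance `𝐖₁^{a,b}` between finite signed
measures, defined via the Jordan decompositions. -/
noncomputable def signedW (a b : ℝ) (μ ν : SignedMeasure X) : ℝ :=
  genW a b (μ.toJordanDecomposition.posPart + ν.toJordanDecomposition.negPart)
    (μ.toJordanDecomposition.negPart + ν.toJordanDecomposition.posPart)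

/-- The empirical (probability) measure of the first `n` points of a sequence. -/
noncomputable def emp (x : ℕ → X) (n : ℕ) : Measure X :=
  (n : ℝ≥0∞)⁻¹ • ∑ k ∈ Finset.range n, Measure.dirac (x k)

/-- The (unnormalized) empirical signed measure of the first `n` points of a sequence. -/
noncomputable def sEmp (x : ℕ → X) (n : ℕ) : SignedMeasure X :=
  ∑ k ∈ Finset.range n, (Measure.dirac (x k)).toSignedMeasure

end Defs

open ProbabilityTheory
open scoped NNReal

section TotalVariation

variable {X : Type*} [MeasurableSpace X]

lemma add_sub_eq_add_sub_swap (μ ν : Measure X) [IsFiniteMeasure μ] [IsFiniteMeasure ν] :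
    μ + (ν - μ) = ν + (μ - ν) := by
  rw [← Measure.toSignedMeasure_eq_toSignedMeasure_iff, Measure.toSignedMeasure_add,
    Measure.toSignedMeasure_add, ← sub_eq_zero, add_sub_add_comm,
    Measure.sub_toSignedMeasure_eq_toSignedMeasure_sub (μ := μ)]
  abel

lemma tvNorm_eq_real (μ ν : Measure X) [IsFiniteMeasure μ] [IsFiniteMeasure ν] :
    tvNorm μ ν = (μ - ν).real Set.univ + (ν - μ).real Set.univ :=
  ENNReal.toReal_add (measure_ne_top _ _) (measure_ne_top _ _)

lemma tvNorm_nonneg (μ ν : Measure X) : 0 ≤ tvNorm μ ν := ENNReal.toReal_nonneg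

lemma tvNorm_comm (μ ν : Measure X) : tvNorm μ ν = tvNorm ν μ := by
  rw [tvNorm, tvNorm, add_comm]

lemma tvNorm_le_of_add_eq {μ ν p q : Measure X} [IsFiniteMeasure p] [IsFiniteMeasure q]
    (h : μ + q = ν + p) : tvNorm μ ν ≤ p.real Set.univ + q.real Set.univ := by
  rw [tvNorm, measureReal_def, measureReal_def,
    ← ENNReal.toReal_add (measure_ne_top _ _) (measure_ne_top _ _)]
  refine ENNReal.toReal_mono
    (ENNReal.add_ne_top.2 ⟨measure_ne_top _ _, measure_ne_top _ _⟩) (add_le_add ?_ ?_)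
  · refine Measure.sub_le_of_le_add ?_ _
    rw [add_comm p, ← h]
    exact Measure.le_add_right le_rfl
  · refine Measure.sub_le_of_le_add ?_ _
    rw [add_comm q, h]
    exact Measure.le_add_right le_rfl

lemma tvNorm_triangle (μ ν ρ : Measure X) [IsFiniteMeasure μ] [IsFiniteMeasure ν]
    [IsFiniteMeasure ρ] : tvNorm μ ρ ≤ tvNorm μ ν + tvNorm ν ρ := by
  have h : μ + ((ν - μ) + (ρ - ν)) = ρ + ((μ - ν) + (ν - ρ)) := by
    rw [← add_assoc, add_sub_eq_add_sub_swap μ ν, add_right_comm, add_sub_eq_add_sub_swap ν ρ]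
    rw [add_assoc, add_comm (ν - ρ)]
  refine (tvNorm_le_of_add_eq h).trans_eq ?_
  rw [tvNorm_eq_real, tvNorm_eq_real, measureReal_add_apply, measureReal_add_apply]
  ring

lemma tvNorm_self_add_left (μ ν : Measure X) [IsFiniteMeasure ν] :
    tvNorm (μ + ν) μ ≤ ν.real Set.univ := by
  simpa using tvNorm_le_of_add_eq (μ := μ + ν) (ν := μ) (p := ν) (q := 0) (by simp)

lemma tvNorm_add_add_le (μ ν γ : Measure X) [IsFiniteMeasure μ] [IsFiniteMeasure ν] :
    tvNorm (μ + γ) (ν + γ) ≤ tvNorm μ ν := by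
  rw [tvNorm_eq_real μ ν]
  refine tvNorm_le_of_add_eq ?_
  rw [add_right_comm, add_sub_eq_add_sub_swap, add_right_comm]

lemma tvNorm_smul_le (c : ℝ≥0) (μ ν : Measure X) [IsFiniteMeasure μ] [IsFiniteMeasure ν] :
    tvNorm (c • μ) (c • ν) ≤ c * tvNorm μ ν := by
  have h : c • μ + c • (ν - μ) = c • ν + c • (μ - ν) := by
    rw [← smul_add, add_sub_eq_add_sub_swap, smul_add]
  refine (tvNorm_le_of_add_eq h).trans_eq ?_
  rw [tvNorm_eq_real, measureReal_nnreal_smul_apply, measureReal_nnreal_smul_apply]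
  ring

/-- Two finite measures have a common part whose complements account for the total variation
distance. -/
lemma exists_common_part (μ ν : Measure X) [IsFiniteMeasure μ] [IsFiniteMeasure ν] :
    ∃ m p q : Measure X, IsFiniteMeasure m ∧ IsFiniteMeasure p ∧ IsFiniteMeasure q ∧
      m + p = μ ∧ m + q = ν ∧ tvNorm μ ν = p.real Set.univ + q.real Set.univ := by
  have hp : (μ - (μ - ν)) + (μ - ν) = μ := Measure.sub_add_cancel_of_le Measure.sub_le
  refine ⟨μ - (μ - ν), μ - ν, ν - μ, inferInstance, inferInstance, inferInstance, hp, ?_,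
    tvNorm_eq_real μ ν⟩
  rw [← Measure.toSignedMeasure_eq_toSignedMeasure_iff]
  apply add_right_cancel (b := (μ - ν).toSignedMeasure)
  rw [← Measure.toSignedMeasure_add, ← Measure.toSignedMeasure_add]
  apply Measure.toSignedMeasure_congr
  rw [add_right_comm, hp, add_sub_eq_add_sub_swap]

end TotalVariation

section Coupling

variable {X : Type*} [MeasurableSpace X]

lemma exists_isCoupling {μ ν : Measure X} [IsFiniteMeasure μ] [IsFiniteMeasure ν]
    (h : μ Set.univ = ν Set.univ) : ∃ π, IsCoupling μ ν π := by
  by_cases h0 : μ Set.univ = 0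
  · have hμ : μ = 0 := Measure.measure_univ_eq_zero.1 h0
    have hν : ν = 0 := Measure.measure_univ_eq_zero.1 (h ▸ h0)
    exact ⟨0, by simp [IsCoupling, hμ, hν]⟩
  · refine ⟨(μ Set.univ)⁻¹ • μ.prod ν, ?_, ?_⟩
    · rw [Measure.map_smul, Measure.map_fst_prod, smul_smul, ← h,
        ENNReal.inv_mul_cancel h0 (measure_ne_top _ _), one_smul]
    · rw [Measure.map_smul, Measure.map_snd_prod, smul_smul,
        ENNReal.inv_mul_cancel h0 (measure_ne_top _ _), one_smul]

lemma fst_map_diag (γ : Measure X) : (γ.map fun x => (x, x)).fst = γ := by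
  rw [Measure.fst, Measure.map_map measurable_fst (by fun_prop)]
  exact Measure.map_id

lemma snd_map_diag (γ : Measure X) : (γ.map fun x => (x, x)).snd = γ := by
  rw [Measure.snd, Measure.map_map measurable_snd (by fun_prop)]
  exact Measure.map_id

end Coupling

section Plans

variable {X : Type*} [MeasurableSpace X] [MetricSpace X]

/-- The generalized transport cost of a plan `π` whose marginals need not be `μ` and `ν`. -/
noncomputable def planCost (a b : ℝ) (μ ν : Measure X) (π : Measure (X × X)) : ℝ :=
  a * (tvNorm μ π.fst + tvNorm ν π.snd) + b * ∫ p : X × X, dist p.1 p.2 ∂π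

lemma W1_bddBelow (μ ν : Measure X) : BddBelow { r : ℝ | ∃ π : Measure (X × X),
    IsCoupling μ ν π ∧ r = ∫ p : X × X, dist p.1 p.2 ∂π } := by
  refine ⟨0, ?_⟩
  rintro _ ⟨π, -, rfl⟩
  exact integral_nonneg fun p => dist_nonneg

lemma W1_nonneg (μ ν : Measure X) : 0 ≤ W1 μ ν := by
  refine Real.sInf_nonneg ?_
  rintro _ ⟨π, -, rfl⟩
  exact integral_nonneg fun p => dist_nonneg

lemma genW_le_planCost {a b : ℝ} (ha : 0 < a) (hb : 0 < b) (μ ν : Measure X)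
    (π : Measure (X × X)) [IsFiniteMeasure π] : genW a b μ ν ≤ planCost a b μ ν π := by
  have hbdd : BddBelow { r : ℝ | ∃ μ' ν' : Measure X, IsFiniteMeasure μ' ∧ IsFiniteMeasure ν' ∧
      μ' Set.univ = ν' Set.univ ∧
      r = a * (tvNorm μ μ' + tvNorm ν ν') + b * W1 μ' ν' } := by
    refine ⟨0, ?_⟩
    rintro _ ⟨μ', ν', -, -, -, rfl⟩
    have h1 := tvNorm_nonneg μ μ'
    have h2 := tvNorm_nonneg ν ν'
    have h3 := W1_nonneg μ' ν'
    positivity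
  have hgen : genW a b μ ν ≤ a * (tvNorm μ π.fst + tvNorm ν π.snd) + b * W1 π.fst π.snd :=
    csInf_le hbdd ⟨π.fst, π.snd, inferInstance, inferInstance,
      Measure.fst_univ.trans Measure.snd_univ.symm, rfl⟩
  have hW : W1 π.fst π.snd ≤ ∫ p : X × X, dist p.1 p.2 ∂π :=
    csInf_le (W1_bddBelow _ _) ⟨π, ⟨rfl, rfl⟩, rfl⟩
  refine hgen.trans ?_
  unfold planCost
  gcongr

lemma exists_planCost_lt {a b : ℝ} (hb : 0 < b) {μ ν : Measure X} {c : ℝ}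
    (hc : genW a b μ ν < c) :
    ∃ π : Measure (X × X), IsFiniteMeasure π ∧ planCost a b μ ν π < c := by
  obtain ⟨_, ⟨μ', ν', hμ', hν', hmass, rfl⟩, hlt⟩ := exists_lt_of_csInf_lt
    (by exact ⟨_, 0, 0, inferInstance, inferInstance, rfl, rfl⟩) hc
  have hW : W1 μ' ν' < (c - a * (tvNorm μ μ' + tvNorm ν ν')) / b := by
    rw [lt_div_iff₀ hb]
    linarith
  obtain ⟨π₀, hπ₀⟩ := exists_isCoupling hmass
  obtain ⟨_, ⟨π, ⟨rfl, rfl⟩, rfl⟩, hπ⟩ := exists_lt_of_csInf_lt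
    (by exact ⟨_, π₀, hπ₀, rfl⟩) hW
  have hfin : IsFiniteMeasure π := by
    refine ⟨?_⟩
    have := measure_lt_top (π.map Prod.fst) Set.univ
    rwa [Measure.map_apply measurable_fst MeasurableSet.univ, Set.preimage_univ] at this
  refine ⟨π, hfin, ?_⟩
  rw [lt_div_iff₀ hb] at hπ
  simp only [planCost, Measure.fst, Measure.snd]
  linarith

lemma genW_smul_le {a b : ℝ} (ha : 0 < a) (hb : 0 < b) (c : ℝ≥0) (μ ν : Measure X)
    [IsFiniteMeasure μ] [IsFiniteMeasure ν] :
    genW a b (c • μ) (c • ν) ≤ c * genW a b μ ν := by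
  have key : ∀ d, genW a b μ ν < d → genW a b (c • μ) (c • ν) ≤ c * d := by
    intro d hd
    obtain ⟨π, hπ, hlt⟩ := exists_planCost_lt hb hd
    refine (genW_le_planCost ha hb _ _ (c • π)).trans ?_
    have h1 := tvNorm_smul_le c μ π.fst
    have h2 := tvNorm_smul_le c ν π.snd
    calc planCost a b (c • μ) (c • ν) (c • π)
        = a * (tvNorm (c • μ) (c • π.fst) + tvNorm (c • ν) (c • π.snd))
          + b * (c * ∫ p : X × X, dist p.1 p.2 ∂π) := by
          rw [planCost, integral_smul_nnreal_measure, Measure.fst, Measure.snd,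
            Measure.map_smul, Measure.map_smul]
          rfl
      _ ≤ a * (c * tvNorm μ π.fst + c * tvNorm ν π.snd)
          + b * (c * ∫ p : X × X, dist p.1 p.2 ∂π) := by gcongr
      _ = c * planCost a b μ ν π := by unfold planCost; ring
      _ ≤ c * d := by gcongr
  refine le_of_forall_pos_le_add fun ε hε => ?_
  have hc : (0 : ℝ) < c + 1 := by positivity
  refine (key (genW a b μ ν + ε / (c + 1)) (by linarith [div_pos hε hc])).trans ?_
  rw [mul_add]
  gcongr
  rw [mul_div_assoc', div_le_iff₀ hc]
  nlinarith

end Plans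

section Compact

variable {X : Type*} [MeasurableSpace X] [MetricSpace X] [BorelSpace X] [CompactSpace X]

lemma integrable_of_continuous_of_compact {Y : Type*} [TopologicalSpace Y] [CompactSpace Y]
    [MeasurableSpace Y] [OpensMeasurableSpace Y] {f : Y → ℝ} (hf : Continuous f)
    (μ : Measure Y) [IsFiniteMeasure μ] : Integrable f μ :=
  (BoundedContinuousFunction.mkOfCompact ⟨f, hf⟩).integrable μ

lemma integrable_dist (π : Measure (X × X)) [IsFiniteMeasure π] :
    Integrable (fun p : X × X => dist p.1 p.2) π :=
  integrable_of_continuous_of_compact (by fun_prop) π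

lemma integral_dist_map_diag (γ : Measure X) :
    ∫ p : X × X, dist p.1 p.2 ∂(γ.map fun x => (x, x)) = 0 := by
  rw [integral_map (by fun_prop)
    (by exact Continuous.aestronglyMeasurable (by fun_prop))]
  simp

lemma genW_add_left_self_le {a b : ℝ} (ha : 0 < a) (hb : 0 < b) (μ γ : Measure X)
    [IsFiniteMeasure μ] [IsFiniteMeasure γ] :
    genW a b (μ + γ) μ ≤ a * γ.real Set.univ := by
  refine (genW_le_planCost ha hb _ _ (μ.map fun x => (x, x))).trans ?_
  rw [planCost, integral_dist_map_diag, fst_map_diag, snd_map_diag]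
  have h1 := tvNorm_self_add_left μ γ
  have h2 := tvNorm_self_add_left μ 0
  simp only [add_zero, measureReal_zero_apply] at h2
  nlinarith

lemma genW_self_add_right_le {a b : ℝ} (ha : 0 < a) (hb : 0 < b) (μ γ : Measure X)
    [IsFiniteMeasure μ] [IsFiniteMeasure γ] :
    genW a b μ (μ + γ) ≤ a * γ.real Set.univ := by
  refine (genW_le_planCost ha hb _ _ (μ.map fun x => (x, x))).trans ?_
  rw [planCost, integral_dist_map_diag, fst_map_diag, snd_map_diag]
  have h1 := tvNorm_self_add_left μ γ
  have h2 := tvNorm_self_add_left μ 0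
  simp only [add_zero, measureReal_zero_apply] at h2
  nlinarith

lemma genW_add_add_le {a b : ℝ} (ha : 0 < a) (hb : 0 < b) (μ ν γ : Measure X)
    [IsFiniteMeasure μ] [IsFiniteMeasure ν] [IsFiniteMeasure γ] :
    genW a b (μ + γ) (ν + γ) ≤ genW a b μ ν := by
  refine le_of_forall_gt_imp_ge_of_dense fun c hc => ?_
  obtain ⟨π, hπ, hlt⟩ := exists_planCost_lt hb hc
  refine (genW_le_planCost ha hb _ _ (π + γ.map fun x => (x, x))).trans (le_trans ?_ hlt.le)
  rw [planCost, integral_add_measure (integrable_dist _) (integrable_dist _),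
    integral_dist_map_diag, add_zero, Measure.fst_add, Measure.snd_add,
    fst_map_diag, snd_map_diag, planCost]
  gcongr
  · exact tvNorm_add_add_le _ _ _
  · exact tvNorm_add_add_le _ _ _

/-- Two plans can be glued along the common part of their intermediate marginals. -/
lemma exists_glued_plan [Nonempty X] (π₁ π₂ : Measure (X × X)) [IsFiniteMeasure π₁]
    [IsFiniteMeasure π₂] :
    ∃ π : Measure (X × X), IsFiniteMeasure π ∧
      tvNorm π₁.fst π.fst + tvNorm π₂.snd π.snd ≤ tvNorm π₁.snd π₂.fst ∧
      ∫ p, dist p.1 p.2 ∂π ≤ ∫ p, dist p.1 p.2 ∂π₁ + ∫ p, dist p.1 p.2 ∂π₂ := by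
  obtain ⟨m, p, q, hm, hp, hq, hmp, hmq, htv⟩ := exists_common_part π₁.snd π₂.fst
  set σ := π₁.map Prod.swap with hσ
  set κ := σ.condKernel
  set η := π₂.condKernel
  have hσ_fst : σ.fst = m + p := by rw [hmp, hσ, Measure.fst_map_swap]
  have hσ_eq : σ = m ⊗ₘ κ + p ⊗ₘ κ := by
    rw [← Measure.compProd_add_left, ← hσ_fst]
    exact (σ.disintegrate κ).symm
  have hπ₂_eq : π₂ = m ⊗ₘ η + q ⊗ₘ η := by
    rw [← Measure.compProd_add_left, hmq]
    exact (π₂.disintegrate η).symm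
  set ρ := m ⊗ₘ (κ ×ₖ η) with hρ
  have hκ : m ⊗ₘ κ = ρ.map (Prod.map id Prod.fst) := by
    rw [hρ, ← Measure.compProd_map measurable_fst, ← Kernel.fst_eq, Kernel.fst_prod]
  have hη : m ⊗ₘ η = ρ.map (Prod.map id Prod.snd) := by
    rw [hρ, ← Measure.compProd_map measurable_snd, ← Kernel.snd_eq, Kernel.snd_prod]
  have h_fst : ρ.snd.fst = (m ⊗ₘ κ).snd := by
    rw [hκ, Measure.snd, Measure.fst, Measure.snd, Measure.map_map (by fun_prop) (by fun_prop),
      Measure.map_map (by fun_prop) (by fun_prop)]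
    rfl
  have h_snd : ρ.snd.snd = (m ⊗ₘ η).snd := by
    rw [hη, Measure.snd, Measure.snd, Measure.snd, Measure.map_map (by fun_prop) (by fun_prop),
      Measure.map_map (by fun_prop) (by fun_prop)]
    rfl
  refine ⟨ρ.snd, inferInstance, ?_, ?_⟩
  · have h1 : π₁.fst = ρ.snd.fst + (p ⊗ₘ κ).snd := by
      rw [h_fst, ← Measure.snd_add, ← hσ_eq, hσ, Measure.snd_map_swap]
    have h2 : π₂.snd = ρ.snd.snd + (q ⊗ₘ η).snd := by
      rw [h_snd, ← Measure.snd_add, ← hπ₂_eq]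
    have h3 : (p ⊗ₘ κ).snd.real Set.univ = p.real Set.univ := by
      simp [measureReal_def]
    have h4 : (q ⊗ₘ η).snd.real Set.univ = q.real Set.univ := by
      simp [measureReal_def]
    rw [htv, h1, h2, ← h3, ← h4]
    exact add_le_add (tvNorm_self_add_left _ _) (tvNorm_self_add_left _ _)
  · have hd : ∀ μ : Measure (X × X), AEStronglyMeasurable (fun p : X × X => dist p.1 p.2) μ :=
      fun μ => Continuous.aestronglyMeasurable (by fun_prop)
    have h1 : ∫ p, dist p.1 p.2 ∂(m ⊗ₘ κ) ≤ ∫ p, dist p.1 p.2 ∂π₁ := by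
      have : ∫ p, dist p.1 p.2 ∂π₁ = ∫ p, dist p.1 p.2 ∂σ := by
        rw [hσ, integral_map (by fun_prop) (hd _)]
        simp [dist_comm]
      rw [this, hσ_eq, integral_add_measure (integrable_dist _) (integrable_dist _)]
      exact le_add_of_nonneg_right (integral_nonneg fun _ => dist_nonneg)
    have h2 : ∫ p, dist p.1 p.2 ∂(m ⊗ₘ η) ≤ ∫ p, dist p.1 p.2 ∂π₂ := by
      conv_rhs => rw [hπ₂_eq]
      rw [integral_add_measure (integrable_dist _) (integrable_dist _)]
      exact le_add_of_nonneg_right (integral_nonneg fun _ => dist_nonneg)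
    refine le_trans ?_ (add_le_add h1 h2)
    rw [hκ, hη, Measure.snd, integral_map (by fun_prop) (hd _),
      integral_map (by fun_prop) (hd _), integral_map (by fun_prop) (hd _),
      ← integral_add (integrable_of_continuous_of_compact (by fun_prop) _)
        (integrable_of_continuous_of_compact (by fun_prop) _)]
    refine integral_mono (integrable_of_continuous_of_compact (by fun_prop) _)
      (integrable_of_continuous_of_compact (by fun_prop) _) fun x => ?_
    exact dist_triangle_left _ _ _

lemma genW_triangle [Nonempty X] {a b : ℝ} (ha : 0 < a) (hb : 0 < b) (μ ν ρ : Measure X)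
    [IsFiniteMeasure μ] [IsFiniteMeasure ν] [IsFiniteMeasure ρ] :
    genW a b μ ρ ≤ genW a b μ ν + genW a b ν ρ := by
  refine le_of_forall_pos_le_add fun ε hε => ?_
  obtain ⟨π₁, hπ₁, hlt₁⟩ := exists_planCost_lt hb
    (show genW a b μ ν < genW a b μ ν + ε / 2 by linarith)
  obtain ⟨π₂, hπ₂, hlt₂⟩ := exists_planCost_lt hb
    (show genW a b ν ρ < genW a b ν ρ + ε / 2 by linarith)
  obtain ⟨π, hπ, htv, hcost⟩ := exists_glued_plan π₁ π₂
  refine (genW_le_planCost ha hb _ _ π).trans ?_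
  have h1 := tvNorm_triangle μ π₁.fst π.fst
  have h2 := tvNorm_triangle ρ π₂.snd π.snd
  have h3 := tvNorm_triangle π₁.snd ν π₂.fst
  rw [tvNorm_comm π₁.snd ν] at h3
  have h4 : a * (tvNorm μ π.fst + tvNorm ρ π.snd) ≤ a * ((tvNorm μ π₁.fst + tvNorm ν π₁.snd)
      + (tvNorm ν π₂.fst + tvNorm ρ π₂.snd)) :=
    mul_le_mul_of_nonneg_left (by linarith) ha.le
  have h5 := mul_le_mul_of_nonneg_left hcost hb.le
  unfold planCost at *
  linarith

lemma genW_nsmul_add_le [Nonempty X] {a b : ℝ} (ha : 0 < a) (hb : 0 < b) (μ ν γ : Measure X)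
    [IsFiniteMeasure μ] [IsFiniteMeasure ν] [IsFiniteMeasure γ] (n : ℕ) :
    genW a b ((n : ℝ≥0) • μ + γ) ((n : ℝ≥0) • ν + γ) ≤ n * genW a b (μ + γ) (ν + γ) := by
  induction n with
  | zero => simpa using genW_add_left_self_le ha hb γ 0
  | succ n ih =>
    have h := genW_triangle ha hb (((n : ℝ≥0) • μ + γ) + μ) (((n : ℝ≥0) • ν + γ) + μ)
      (((n : ℝ≥0) • ν + γ) + ν)
    have h1 := genW_add_add_le ha hb ((n : ℝ≥0) • μ + γ) ((n : ℝ≥0) • ν + γ) μ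
    have h2 := genW_add_add_le ha hb (μ + γ) (ν + γ) ((n : ℝ≥0) • ν)
    have e1 : (μ + γ) + (n : ℝ≥0) • ν = ((n : ℝ≥0) • ν + γ) + μ := by abel
    have e2 : (ν + γ) + (n : ℝ≥0) • ν = ((n : ℝ≥0) • ν + γ) + ν := by abel
    have e3 : ∀ ξ : Measure X, ((n + 1 : ℕ) : ℝ≥0) • ξ + γ = ((n : ℝ≥0) • ξ + γ) + ξ := by
      intro ξ
      rw [Nat.cast_succ, add_smul, one_smul]
      abel
    rw [e1, e2] at h2
    rw [e3, e3]
    push_cast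
    linarith

/-- The generalized Wasserstein distance is invariant under adding a common measure. -/
lemma genW_add_add_eq {a b : ℝ} (ha : 0 < a) (hb : 0 < b) (μ ν γ : Measure X)
    [IsFiniteMeasure μ] [IsFiniteMeasure ν] [IsFiniteMeasure γ] :
    genW a b (μ + γ) (ν + γ) = genW a b μ ν := by
  refine le_antisymm (genW_add_add_le ha hb μ ν γ) ?_
  rcases isEmpty_or_nonempty X with hX | hX
  · rw [Subsingleton.elim (μ + γ) μ, Subsingleton.elim (ν + γ) ν]
  have key (n : ℕ) : n * (genW a b μ ν - genW a b (μ + γ) (ν + γ))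
      ≤ 2 * a * γ.real Set.univ := by
    rcases Nat.eq_zero_or_pos n with rfl | hn
    · simp only [Nat.cast_zero, zero_mul]
      positivity
    have hn' : (n : ℝ≥0) ≠ 0 := by exact_mod_cast hn.ne'
    have h1 := genW_triangle ha hb ((n : ℝ≥0) • μ) ((n : ℝ≥0) • μ + γ) ((n : ℝ≥0) • ν)
    have h2 := genW_triangle ha hb ((n : ℝ≥0) • μ + γ) ((n : ℝ≥0) • ν + γ) ((n : ℝ≥0) • ν)
    have h3 := genW_self_add_right_le ha hb ((n : ℝ≥0) • μ) γ
    have h4 := genW_add_left_self_le ha hb ((n : ℝ≥0) • ν) γ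
    have h5 := genW_nsmul_add_le ha hb μ ν γ n
    have h6 := genW_smul_le ha hb ((n : ℝ≥0)⁻¹) ((n : ℝ≥0) • μ) ((n : ℝ≥0) • ν)
    rw [smul_smul, smul_smul, inv_mul_cancel₀ hn', one_smul, one_smul, NNReal.coe_inv,
      NNReal.coe_natCast, inv_mul_eq_div, le_div_iff₀ (by exact_mod_cast hn)] at h6
    linarith
  by_contra! hlt
  obtain ⟨n, hn⟩ := exists_nat_gt
    (2 * a * γ.real Set.univ / (genW a b μ ν - genW a b (μ + γ) (ν + γ)))
  rw [div_lt_iff₀ (sub_pos.2 hlt)] at hn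
  exact (key n).not_gt hn

end Compact

lemma toSignedMeasure_posPart_sub_negPart {X : Type*} [MeasurableSpace X] (μ : SignedMeasure X) :
    μ.toJordanDecomposition.posPart.toSignedMeasure
      - μ.toJordanDecomposition.negPart.toSignedMeasure = μ :=
  μ.toSignedMeasure_toJordanDecomposition

/-- The signed generalized Wasserstein distance is invariant under
adding a common signed measure: `𝐖₁^{a,b}(μ + η, ν + η) = 𝐖₁^{a,b}(μ, ν)`. -/
theorem signedW_add_right_invariant {X : Type*} [MeasurableSpace X] [MetricSpace X]
    [BorelSpace X] [CompactSpace X] (a b : ℝ) (ha : 0 < a) (hb : 0 < b)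
    (μ ν η : SignedMeasure X) :
    signedW a b (μ + η) (ν + η) = signedW a b μ ν := by
  unfold signedW
  set α := μ.toJordanDecomposition.posPart + ν.toJordanDecomposition.negPart with hα
  set β := μ.toJordanDecomposition.negPart + ν.toJordanDecomposition.posPart with hβ
  set α' := (μ + η).toJordanDecomposition.posPart + (ν + η).toJordanDecomposition.negPart
    with hα'
  set β' := (μ + η).toJordanDecomposition.negPart + (ν + η).toJordanDecomposition.posPart
    with hβ'
  have h : α' + β = α + β' := by
    rw [← Measure.toSignedMeasure_eq_toSignedMeasure_iff, ← sub_eq_zero]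
    simp only [hα, hβ, hα', hβ', Measure.toSignedMeasure_add]
    calc _ = ((μ + η).toJordanDecomposition.posPart.toSignedMeasure
            - (μ + η).toJordanDecomposition.negPart.toSignedMeasure)
          - ((ν + η).toJordanDecomposition.posPart.toSignedMeasure
            - (ν + η).toJordanDecomposition.negPart.toSignedMeasure)
          - ((μ.toJordanDecomposition.posPart.toSignedMeasure
            - μ.toJordanDecomposition.negPart.toSignedMeasure)
          - (ν.toJordanDecomposition.posPart.toSignedMeasure
            - ν.toJordanDecomposition.negPart.toSignedMeasure)) := by abel
      _ = (μ + η) - (ν + η) - (μ - ν) := by simp only [toSignedMeasure_posPart_sub_negPart]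
      _ = 0 := by abel
  rw [← genW_add_add_eq ha hb α' β' β, ← genW_add_add_eq ha hb α β β', h, add_comm β']
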